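/- arXiv:1204.5357 — 9 statements merged into one kernel-verified Lean document; each statement's English description precedes it below -/
import Mathlib

section
/- Let G be a chain graph over a finite vertex set V, and let ⊥ be a ternary relation among pairwise disjoint subsets of V satisfying symmetry, decomposition, weak union, contraction, intersection and composition. Then L1(A) and L2(A) hold for all A ∈ V if and only if C1(A) and C2(A) hold for all A ∈ V. -/
/-- There is an edge between `a` and `b`: a directed edge `a → b`, a directed edge
`b → a`, or an undirected edge `a − b`. -/
def Adj (dir und : V → V → Prop) (a b : V) : Prop :=
  dir a b ∨ dir b a ∨ und a b ∨ und b a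

/-- A hybrid graph: undirected edges are symmetric, there are no self loops, and there
is at most one edge between any pair of distinct nodes. -/
def IsHybrid (dir und : V → V → Prop) : Prop :=
  (∀ a b, und a b → und b a) ∧
  (∀ a b, dir a b → a ≠ b) ∧
  (∀ a b, und a b → a ≠ b) ∧
  (∀ a b, dir a b → ¬ dir b a) ∧
  (∀ a b, dir a b → ¬ und a b ∧ ¬ und b a)

/-- Every pair of consecutive elements of the list `l` is related by `R`. -/
def ChainRel (R : V → V → Prop) (l : List V) : Prop :=
  ∀ (i : ℕ) (a b : V), l[i]? = some a → l[i + 1]? = some b → R a b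

/-- The list `l` is a route in the graph, i.e. consecutive nodes are adjacent
(and `l` is nonempty). -/
def IsRoute (dir und : V → V → Prop) (l : List V) : Prop :=
  l ≠ [] ∧ ChainRel (Adj dir und) l

/-- The list `l` is a descending route: every step is `a → b` or `a − b`. -/
def IsDescRouteList (dir und : V → V → Prop) (l : List V) : Prop :=
  l ≠ [] ∧ ChainRel (fun a b => dir a b ∨ und a b) l

/-- There is a descending route from `a` to `b`. -/
def DescRoute (dir und : V → V → Prop) (a b : V) : Prop :=
  ∃ l : List V, l.head? = some a ∧ l.getLast? = some b ∧
    ChainRel (fun x y => dir x y ∨ und x y) l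

/-- The list `l` is a semidirected cycle. -/
def SemidirectedCycle (dir und : V → V → Prop) (l : List V) : Prop :=
  2 ≤ l.length ∧ l.head? = l.getLast? ∧
  ChainRel (fun a b => dir a b ∨ und a b) l ∧
  ∃ (i : ℕ) (a b : V), l[i]? = some a ∧ l[i + 1]? = some b ∧ dir a b

/-- A chain graph is a hybrid graph with no semidirected cycle. -/
def IsChainGraph (dir und : V → V → Prop) : Prop :=
  IsHybrid dir und ∧ ∀ l : List V, ¬ SemidirectedCycle dir und l

/-- The parents of the set of nodes `X`. -/
def pa (dir : V → V → Prop) (X : Set V) : Set V :=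
  {v | v ∉ X ∧ ∃ w ∈ X, dir v w}

/-- The neighbors of the set of nodes `X`. -/
def nbr (und : V → V → Prop) (X : Set V) : Set V :=
  {v | v ∉ X ∧ ∃ w ∈ X, und v w}

/-- The adjacents of the set of nodes `X`. -/
def adSet (dir und : V → V → Prop) (X : Set V) : Set V :=
  {v | v ∉ X ∧ ∃ w ∈ X, Adj dir und v w}

/-- The descendants of the set of nodes `X`. -/
def de (dir und : V → V → Prop) (X : Set V) : Set V :=
  {v | v ∉ X ∧ ∃ w ∈ X, DescRoute dir und w v}

/-- The connectivity component of the node `a`: all nodes reachable from `a` by a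
route whose edges are all undirected. -/
def co (und : V → V → Prop) (a : V) : Set V :=
  {b | Relation.ReflTransGen und a b}

/-- `b` is a head-no-tail node in the subroute `a, b, c`, i.e. the subroute is of
the form `a → b ← c`, `a → b − c` or `a − b ← c`. -/
def HeadNoTail (dir und : V → V → Prop) (a b c : V) : Prop :=
  (dir a b ∧ dir c b) ∨ (dir a b ∧ und b c) ∨ (und a b ∧ dir c b)

/-- The route `l` is `Z`-open: every head-no-tail (occurrence of a) node is in `Z`
and every other (occurrence of a) node is not in `Z`. -/
def ZOpen (dir und : V → V → Prop) (Z : Set V) (l : List V) : Prop :=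
  ChainRel (Adj dir und) l ∧
  (∀ (i : ℕ) (a b c : V), l[i]? = some a → l[i + 1]? = some b → l[i + 2]? = some c →
    (HeadNoTail dir und a b c ↔ b ∈ Z)) ∧
  (∀ a, l.head? = some a → a ∉ Z) ∧
  (∀ a, l.getLast? = some a → a ∉ Z)

/-- `X` is separated from `Y` given `Z`: there is no `Z`-open route between a node
of `X` and a node of `Y`. -/
def Separ (dir und : V → V → Prop) (X Y Z : Set V) : Prop :=
  ¬ ∃ (l : List V) (x y : V), x ∈ X ∧ y ∈ Y ∧ l.head? = some x ∧ l.getLast? = some y ∧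
      ZOpen dir und Z l

/-- The graph has a triplex `({A,C},B)`: an induced subgraph of the form `A → B ← C`,
`A → B − C` or `A − B ← C`. -/
def Triplex (dir und : V → V → Prop) (A B C : V) : Prop :=
  A ≠ C ∧ ¬ Adj dir und A C ∧
  ((dir A B ∧ dir C B) ∨ (dir A B ∧ und B C) ∨ (und A B ∧ dir C B))

/-- The graph has an immorality `A → B ← C`. -/
def Immorality (dir und : V → V → Prop) (A B C : V) : Prop :=
  A ≠ C ∧ ¬ Adj dir und A C ∧ dir A B ∧ dir C B

/-- The graph has a flag `A → B − C`. -/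
def FlagIn (dir und : V → V → Prop) (A B C : V) : Prop :=
  A ≠ C ∧ ¬ Adj dir und A C ∧ dir A B ∧ und B C

theorem chainRel_iff_isChain {V : Type*} {R : V → V → Prop} {l : List V} :
    ChainRel R l ↔ l.IsChain R := by
  rw [List.isChain_iff_getElem]
  constructor
  · intro h i hi
    exact h i _ _ (List.getElem?_eq_getElem _) (List.getElem?_eq_getElem _)
  · intro h i a b ha hb
    obtain ⟨hi, rfl⟩ := List.getElem?_eq_some_iff.1 ha
    obtain ⟨hi', rfl⟩ := List.getElem?_eq_some_iff.1 hb
    exact h i hi'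

theorem descRoute_iff_reflTransGen {V : Type*} {dir und : V → V → Prop} {a b : V} :
    DescRoute dir und a b ↔ Relation.ReflTransGen (fun x y => dir x y ∨ und x y) a b := by
  constructor
  · rintro ⟨l, hhead, hlast, hl⟩
    rw [chainRel_iff_isChain] at hl
    cases l with
    | nil => simp at hhead
    | cons c l =>
      obtain rfl : c = a := by simpa using hhead
      refine List.relationReflTransGen_of_exists_isChain_cons l hl ?_
      simpa [List.getLast?_eq_getLast_of_ne_nil] using hlast
  · intro h
    obtain ⟨l, hl, hlast⟩ := List.exists_isChain_cons_of_relationReflTransGen h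
    exact ⟨a :: l, rfl, by simp [List.getLast?_eq_getLast_of_ne_nil, hlast],
      chainRel_iff_isChain.2 hl⟩

/-- In a chain graph, the head of a directed edge has no descending route to its tail. -/
theorem IsChainGraph.not_reflTransGen {V : Type*} {dir und : V → V → Prop}
    (hG : IsChainGraph dir und) {a b : V} (hab : dir a b) :
    ¬ Relation.ReflTransGen (fun x y => dir x y ∨ und x y) b a := by
  intro h
  obtain ⟨l, hl, hlast⟩ := List.exists_isChain_cons_of_relationReflTransGen h
  refine hG.2 (a :: b :: l) ⟨by simp, ?_, ?_, 0, a, b, rfl, rfl, hab⟩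
  · simp [List.getLast?_eq_getLast_of_ne_nil, hlast]
  · exact chainRel_iff_isChain.2 (List.isChain_cons_cons.2 ⟨.inl hab, hl⟩)

theorem reflTransGen_of_mem_co {V : Type*} {dir und : V → V → Prop} {a b : V}
    (h : b ∈ co und a) : Relation.ReflTransGen (fun x y => dir x y ∨ und x y) a b :=
  Relation.ReflTransGen.mono (fun _ _ => Or.inr) _ _ h

theorem co_eq_of_mem {V : Type*} {und : V → V → Prop} (hsymm : ∀ a b, und a b → und b a)
    {a b : V} (h : b ∈ co und a) : co und b = co und a := by
  have hba : Relation.ReflTransGen und b a :=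
    Relation.ReflTransGen.mono (fun _ _ => hsymm _ _) _ _ (Relation.ReflTransGen.swap _ _ h)
  ext c
  exact ⟨fun hc => h.trans hc, fun hc => hba.trans hc⟩

theorem self_union_de_eq {V : Type*} (dir und : V → V → Prop) (a : V) :
    {a} ∪ de dir und {a} = co und a ∪ de dir und (co und a) := by
  ext v
  simp only [Set.mem_union, Set.mem_singleton_iff, de, Set.mem_ofPred_eq, exists_eq_left,
    descRoute_iff_reflTransGen]
  constructor
  · rintro (rfl | ⟨-, h⟩)
    · exact .inl .refl
    · by_cases hv : v ∈ co und a
      · exact .inl hv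
      · exact .inr ⟨hv, a, .refl, h⟩
  · intro h
    by_cases hv : v = a
    · exact .inl hv
    · refine .inr ⟨hv, ?_⟩
      rcases h with h | ⟨-, w, hw, h⟩
      · exact reflTransGen_of_mem_co h
      · exact (reflTransGen_of_mem_co hw).trans h

/-- In a chain graph, the parents of nodes of a component are nondescendants of it. -/
theorem IsChainGraph.pa_subset {V : Type*} {dir und : V → V → Prop}
    (hG : IsChainGraph dir und) {a : V} {X : Set V} (hX : X ⊆ co und a) :
    pa dir X ⊆ Set.univ \ (co und a ∪ de dir und (co und a)) := by
  rintro v ⟨-, w, hw, hvw⟩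
  refine ⟨trivial, fun h => hG.not_reflTransGen hvw ?_⟩
  have hwa := reflTransGen_of_mem_co (dir := dir) (b := a)
    (by rw [co_eq_of_mem hG.1.1 (hX hw)]; exact .refl : a ∈ co und w)
  rw [← self_union_de_eq] at h
  simp only [Set.mem_union, Set.mem_singleton_iff, de, Set.mem_ofPred_eq, exists_eq_left,
    descRoute_iff_reflTransGen] at h
  rcases h with rfl | ⟨-, h⟩
  · exact hwa
  · exact hwa.trans h

theorem stmt_0 {V : Type} [Fintype V] (dir und : V → V → Prop)
    (hG : IsChainGraph dir und)
    (indep : Set V → Set V → Set V → Prop)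
    (hsym : ∀ X Y Z : Set V, Disjoint X Y → Disjoint X Z → Disjoint Y Z →
      indep X Y Z → indep Y X Z)
    (hdec : ∀ X Y Z W : Set V, Disjoint X Y → Disjoint X Z → Disjoint X W →
      Disjoint Y Z → Disjoint Y W → Disjoint Z W →
      indep X (Y ∪ W) Z → indep X Y Z)
    (hwu : ∀ X Y Z W : Set V, Disjoint X Y → Disjoint X Z → Disjoint X W →
      Disjoint Y Z → Disjoint Y W → Disjoint Z W →
      indep X (Y ∪ W) Z → indep X Y (Z ∪ W))
    (hcon : ∀ X Y Z W : Set V, Disjoint X Y → Disjoint X Z → Disjoint X W →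
      Disjoint Y Z → Disjoint Y W → Disjoint Z W →
      indep X Y (Z ∪ W) → indep X W Z → indep X (Y ∪ W) Z)
    (hint : ∀ X Y Z W : Set V, Disjoint X Y → Disjoint X Z → Disjoint X W →
      Disjoint Y Z → Disjoint Y W → Disjoint Z W →
      indep X Y (Z ∪ W) → indep X W (Z ∪ Y) → indep X (Y ∪ W) Z)
    (hcomp : ∀ X Y Z W : Set V, Disjoint X Y → Disjoint X Z → Disjoint X W →
      Disjoint Y Z → Disjoint Y W → Disjoint Z W →
      indep X Y Z → indep X W Z → indep X (Y ∪ W) Z) :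
    (∀ A : V,
      indep {A} (co und A \ ({A} ∪ nbr und {A}))
        ((Set.univ \ (co und A ∪ de dir und (co und A))) ∪ nbr und {A}) ∧
      indep {A} (Set.univ \ (co und A ∪ de dir und (co und A) ∪ pa dir {A})) (pa dir {A}))
    ↔
    (∀ A : V,
      indep {A} (co und A \ ({A} ∪ nbr und {A}))
        (pa dir ({A} ∪ nbr und {A}) ∪ nbr und {A}) ∧
      indep {A} (Set.univ \ ({A} ∪ de dir und {A} ∪ pa dir {A})) (pa dir {A})) := by
  have key : ∀ A : V,
      (∀ B : V, indep {B}
        (Set.univ \ (co und B ∪ de dir und (co und B) ∪ pa dir {B})) (pa dir {B})) →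
      indep {A}
        ((Set.univ \ (co und A ∪ de dir und (co und A))) \ pa dir ({A} ∪ nbr und {A}))
        (pa dir ({A} ∪ nbr und {A}) ∪ nbr und {A}) := by
    intro A hL
    have hne : {A} ∪ nbr und {A} ⊆ co und A := by
      rintro v (rfl | ⟨-, w, rfl, h⟩)
      · exact .refl
      · exact .single (hG.1.1 _ _ h)
    have hP := hG.pa_subset hne
    have hpa : ∀ B ∈ {A} ∪ nbr und {A}, pa dir {B} ⊆ pa dir ({A} ∪ nbr und {A}) := by
      intro B hB v hv
      have hvT := hG.pa_subset (Set.singleton_subset_iff.2 (hne hB)) hv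
      obtain ⟨-, w, rfl, hvw⟩ := hv
      exact ⟨fun h => hvT.2 (.inl (hne h)), w, hB, hvw⟩
    have hAne : Disjoint {A} (nbr und {A}) :=
      Set.disjoint_singleton_left.2 fun h => h.1 rfl
    have hco : ∀ B ∈ {A} ∪ nbr und {A}, co und B = co und A :=
      fun B hB => co_eq_of_mem hG.1.1 (hne hB)
    set N := Set.univ \ (co und A ∪ de dir und (co und A)) with hN
    set P := pa dir ({A} ∪ nbr und {A})
    set S := nbr und {A}
    have hNT : Disjoint N ({A} ∪ S) :=
      Set.disjoint_left.2 fun v hv h => hv.2 (.inl (hne h))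
    have hpt : ∀ B ∈ {A} ∪ S, indep (N \ P) {B} P := by
      intro B hB
      have hBN : B ∉ N := fun h => Set.disjoint_left.1 hNT h hB
      have hBP : B ∉ P := fun h => hBN (hP h)
      have hpB := hpa B hB
      have h := hL B
      rw [hco B hB] at h
      have e : Set.univ \ (co und A ∪ de dir und (co und A) ∪ pa dir {B})
          = (N \ P) ∪ (P \ pa dir {B}) := by
        ext v
        have h1 := @hP v
        have h2 := @hpB v
        simp only [hN, Set.mem_sdiff, Set.mem_union, Set.mem_univ, true_and] at h1 ⊢
        tauto
      rw [e] at h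
      have h' := hwu _ _ _ _
        (by simp [hBN]) (by simpa using fun h => hBP (hpB h)) (by simp [hBP])
        (Set.disjoint_left.2 fun v hv h => hv.2 (hpB h))
        (Set.disjoint_left.2 fun v hv h => hv.2 h.1)
        Set.disjoint_sdiff_right h
      rw [Set.union_sdiff_cancel hpB] at h'
      exact hsym _ _ _ (by simp [hBN]) (by simp [hBP]) Set.disjoint_sdiff_left h'
    have hall : ∀ s : Set V, s ⊆ S → indep (N \ P) ({A} ∪ s) P := by
      intro s
      induction s, s.toFinite using Set.Finite.induction_on with
      | empty => intro _; simpa using hpt A (.inl rfl)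
      | @insert b s hb _ ih =>
        intro hs
        have hbS : b ∈ S := hs (Set.mem_insert _ _)
        have hsS : s ⊆ S := (Set.subset_insert _ _).trans hs
        have hsub : {A} ∪ s ⊆ {A} ∪ S := Set.union_subset_union_right _ hsS
        have hbsub : {b} ⊆ {A} ∪ S := Set.singleton_subset_iff.2 (.inr hbS)
        have hPT : Disjoint P ({A} ∪ S) := hNT.mono_left hP
        have hNPT : Disjoint (N \ P) ({A} ∪ S) := hNT.mono_left Set.sdiff_subset
        have hbA : b ≠ A := fun h => hbS.1 h
        have h := hcomp _ _ _ _ (hNPT.mono_right hsub) Set.disjoint_sdiff_left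
          (hNPT.mono_right hbsub) (hPT.mono_right hsub).symm
          (by simp [hb, hbA]) (hPT.mono_right hbsub) (ih hsS) (hpt b (.inr hbS))
        rwa [Set.union_assoc, Set.union_singleton (s := s)] at h
    have hPT : Disjoint P ({A} ∪ S) := hNT.mono_left hP
    have hNPT : Disjoint (N \ P) ({A} ∪ S) := hNT.mono_left Set.sdiff_subset
    have hA : {A} ⊆ {A} ∪ S := Set.subset_union_left
    have hS : S ⊆ {A} ∪ S := Set.subset_union_right
    have h := hwu _ _ _ _ (hNPT.mono_right hA) Set.disjoint_sdiff_left (hNPT.mono_right hS)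
      (hPT.mono_right hA).symm hAne (hPT.mono_right hS) (hall S subset_rfl)
    exact hsym _ _ _ (hNPT.mono_right hA)
      (Set.disjoint_union_right.2 ⟨Set.disjoint_sdiff_left, hNPT.mono_right hS⟩)
      (Set.disjoint_union_right.2 ⟨(hPT.mono_right hA).symm, hAne⟩) h
  simp only [self_union_de_eq, forall_and]
  refine and_congr_left fun hL => forall_congr' fun A => ?_
  have hK := key A hL
  have hne : {A} ∪ nbr und {A} ⊆ co und A := by
    rintro v (rfl | ⟨-, w, rfl, h⟩)
    · exact .refl
    · exact .single (hG.1.1 _ _ h)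
  have hP := hG.pa_subset hne
  have hAne : Disjoint {A} (nbr und {A}) :=
    Set.disjoint_singleton_left.2 fun h => h.1 rfl
  have hNT : Disjoint (Set.univ \ (co und A ∪ de dir und (co und A))) (co und A) :=
    Set.disjoint_left.2 fun v hv h => hv.2 (.inl h)
  set N := Set.univ \ (co und A ∪ de dir und (co und A))
  set P := pa dir ({A} ∪ nbr und {A})
  set S := nbr und {A}
  set R := co und A \ ({A} ∪ S)
  have hA : {A} ⊆ co und A := Set.subset_union_left.trans hne
  have hS : S ⊆ co und A := Set.subset_union_right.trans hne
  have hR : R ⊆ co und A := Set.sdiff_subset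
  have hAR : Disjoint {A} R := Set.disjoint_sdiff_right.mono_left Set.subset_union_left
  have hSR : Disjoint S R := Set.disjoint_sdiff_right.mono_left Set.subset_union_right
  have hPT : Disjoint P (co und A) := hNT.mono_left hP
  have hQT : Disjoint (N \ P) (co und A) := hNT.mono_left Set.sdiff_subset
  have hAZ : Disjoint {A} (P ∪ S) :=
    Set.disjoint_union_right.2 ⟨(hPT.mono_right hA).symm, hAne⟩
  have hAQ : Disjoint {A} (N \ P) := (hQT.mono_right hA).symm
  have hRZ : Disjoint R (P ∪ S) :=
    Set.disjoint_union_right.2 ⟨(hPT.mono_right hR).symm, hSR.symm⟩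
  have hRQ : Disjoint R (N \ P) := (hQT.mono_right hR).symm
  have hZQ : Disjoint (P ∪ S) (N \ P) :=
    Set.disjoint_union_left.2 ⟨Set.disjoint_sdiff_right, (hQT.mono_right hS).symm⟩
  have e : N ∪ S = P ∪ S ∪ N \ P := by
    rw [Set.union_right_comm, Set.union_sdiff_cancel hP]
  rw [e]
  constructor
  · intro h
    exact hdec _ _ _ _ hAR hAZ hAQ hRZ hRQ hZQ
      (hcon _ _ _ _ hAR hAZ hAQ hRZ hRQ hZQ h hK)
  · intro h
    exact hwu _ _ _ _ hAR hAZ hAQ hRZ hRQ hZQ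
      (hcomp _ _ _ _ hAR hAZ hAQ hRZ hRQ hZQ h hK)
end

section
/- For every chain graph G over a finite vertex set V and every node A ∈ V, the separation A ⊥_G co_G(A) ∖ ({A} ∪ ne_G(A)) | pa_G({A} ∪ ne_G(A)) ∪ ne_G(A) holds. -/
/-- A relation between consecutive entries of `l` still holds after prepending an element
related to the head of `l`. -/
theorem ChainRel.cons {V : Type} {R : V → V → Prop} {a b : V} {l : List V}
    (hl : ChainRel R l) (hb : l.head? = some b) (hab : R a b) : ChainRel R (a :: l) := by
  intro i x y hx hy
  cases i with
  | zero =>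
    have hxa : a = x := by simpa using hx
    have hyb : b = y := by
      rw [List.head?_eq_getElem?] at hb
      simpa [hb] using hy
    exact hxa ▸ hyb ▸ hab
  | succ i => exact hl i x y (by simpa using hx) (by simpa using hy)

/-- Reachability is witnessed by a list of nodes with consecutive nodes related. -/
theorem exists_chainRel_of_reflTransGen {V : Type} {R : V → V → Prop} {a b : V}
    (h : Relation.ReflTransGen R a b) :
    ∃ l : List V, l.head? = some a ∧ l.getLast? = some b ∧ ChainRel R l := by
  induction h using Relation.ReflTransGen.head_induction_on with
  | refl => exact ⟨[b], rfl, rfl, fun i x y _ hy => by simp at hy⟩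
  | @head a c hac _ ih =>
    obtain ⟨l, hhead, hlast, hl⟩ := ih
    refine ⟨a :: l, rfl, ?_, hl.cons hhead hac⟩
    simp [List.getLast?_cons, hlast]

/-- In a chain graph, the tail of a directed edge is not reachable from its head by a
descending route. -/
theorem IsChainGraph.not_reflTransGen_of_dir {V : Type} {dir und : V → V → Prop}
    (hG : IsChainGraph dir und) {a b : V} (hab : dir a b) :
    ¬ Relation.ReflTransGen (fun x y => dir x y ∨ und x y) b a := by
  intro h
  obtain ⟨l, hhead, hlast, hl⟩ := exists_chainRel_of_reflTransGen h
  refine hG.2 (a :: l) ⟨?_, ?_, hl.cons hhead (Or.inl hab), 0, a, b, rfl, ?_, hab⟩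
  · cases l <;> simp_all
  · simp [List.getLast?_cons, hlast]
  · simpa [List.head?_eq_getElem?] using hhead

/-- An open route leaving `a` by a directed edge stays directed as long as no node
reachable from the second node belongs to the conditioning set. -/
theorem ZOpen.directed_of_dir {V : Type} {dir und : V → V → Prop} {Z : Set V} {l : List V}
    (hl : ZOpen dir und Z l) (hund : ∀ x y, und x y → und y x) {a b : V}
    (ha : l[0]? = some a) (hb : l[1]? = some b) (hab : dir a b)
    (hZ : ∀ c, Relation.ReflTransGen (fun x y => dir x y ∨ und x y) b c → c ∉ Z)
    (i : ℕ) (c : V) (hc : l[i + 1]? = some c) :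
    (∃ p, l[i]? = some p ∧ dir p c) ∧
      Relation.ReflTransGen (fun x y => dir x y ∨ und x y) b c := by
  induction i generalizing c with
  | zero =>
    obtain rfl : b = c := by simpa [hb] using hc
    exact ⟨⟨a, ha, hab⟩, .refl⟩
  | succ i ih =>
    obtain ⟨hlen, -⟩ := List.getElem?_eq_some_iff.1 hc
    have hd : l[i + 1]? = some l[i + 1] := List.getElem?_eq_getElem (by omega)
    generalize l[i + 1] = d at hd
    obtain ⟨⟨p, hp, hpd⟩, hbd⟩ := ih d hd
    have hnot : ¬ HeadNoTail dir und p d c := fun h =>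
      hZ d hbd ((hl.2.1 i p d c hp hd hc).1 h)
    have hdc : dir d c := by
      rcases hl.1 (i + 1) d c hd hc with h | h | h | h
      · exact h
      · exact (hnot (Or.inl ⟨hpd, h⟩)).elim
      · exact (hnot (Or.inr (Or.inl ⟨hpd, h⟩))).elim
      · exact (hnot (Or.inr (Or.inl ⟨hpd, hund _ _ h⟩))).elim
    exact ⟨⟨d, hd, hdc⟩, hbd.tail (Or.inl hdc)⟩

/-- If the node of an open route at position `i + 1` is in the conditioning set, then the
route continues and the node is a head-no-tail node. -/
theorem ZOpen.exists_headNoTail {V : Type} {dir und : V → V → Prop} {Z : Set V} {l : List V}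
    (hl : ZOpen dir und Z l) {i : ℕ} {a b : V} (ha : l[i]? = some a)
    (hb : l[i + 1]? = some b) (hbZ : b ∈ Z) :
    ∃ c, l[i + 2]? = some c ∧ HeadNoTail dir und a b c := by
  cases hc : l[i + 2]? with
  | some c => exact ⟨c, rfl, (hl.2.1 i a b c ha hb hc).2 hbZ⟩
  | none =>
    refine (hl.2.2.2 b ?_ hbZ).elim
    obtain ⟨hlen, -⟩ := List.getElem?_eq_some_iff.1 hb
    have hlen' := List.getElem?_eq_none_iff.1 hc
    rw [List.getLast?_eq_getElem?, show l.length - 1 = i + 1 by omega, hb]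

theorem stmt_3 {V : Type} [Fintype V] (dir und : V → V → Prop)
    (hG : IsChainGraph dir und) (A : V) :
    Separ dir und {A} (co und A \ ({A} ∪ nbr und {A}))
      (pa dir ({A} ∪ nbr und {A}) ∪ nbr und {A}) := by
  rintro ⟨l, x, B, rfl, ⟨hBco, hBnot⟩, hhead, hlast, hl⟩
  obtain ⟨hund, -, hundne, hasymm, hexcl⟩ := hG.1
  rw [List.head?_eq_getElem?] at hhead
  rw [List.getLast?_eq_getElem?] at hlast
  have hnbr : ∀ c, und x c → c ∈ nbr und {x} := fun c hc =>
    ⟨fun h => hundne _ _ hc (Set.mem_singleton_iff.1 h).symm, x, rfl, hund _ _ hc⟩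
  have hpa : ∀ c w, (w = x ∨ und x w) → dir c w →
      c ∈ pa dir ({x} ∪ nbr und {x}) ∪ nbr und {x} := by
    intro c w hw hcw
    refine Or.inl ⟨?_, w, hw.imp id (hnbr w), hcw⟩
    have hwx : Relation.ReflTransGen (fun x y => dir x y ∨ und x y) w x := by
      rcases hw with rfl | hw
      · exact .refl
      · exact .single (Or.inr (hund _ _ hw))
    rintro (rfl | ⟨-, y, rfl, hcy⟩)
    · exact hG.not_reflTransGen_of_dir hcw hwx
    · exact hG.not_reflTransGen_of_dir hcw (hwx.tail (Or.inr (hund _ _ hcy)))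
  -- The route cannot step from `x` or a neighbour of `x` to a parent of it.
  have hblocked : ∀ i c w, (w = x ∨ und x w) → l[i]? = some w → l[i + 1]? = some c →
      ¬ dir c w := by
    intro i c w hw hiw hic hcw
    obtain ⟨d, -, h⟩ := hl.exists_headNoTail hiw hic (hpa c w hw hcw)
    rcases h with ⟨h, -⟩ | ⟨h, -⟩ | ⟨h, -⟩
    · exact hasymm _ _ h hcw
    · exact hasymm _ _ h hcw
    · exact (hexcl _ _ hcw).2 h
  have hundcase : ∀ c, l[1]? = some c → ¬ und x c := by
    intro c hc hxc
    obtain ⟨d, hd, h⟩ := hl.exists_headNoTail hhead hc (Or.inr (hnbr c hxc))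
    rcases h with ⟨h, -⟩ | ⟨h, -⟩ | ⟨-, h⟩
    · exact (hexcl _ _ h).1 hxc
    · exact (hexcl _ _ h).1 hxc
    · exact hblocked 1 d c (Or.inr hxc) hc hd h
  cases hc : l[1]? with
  | none =>
    have hlen := List.getElem?_eq_none_iff.1 hc
    rw [show l.length - 1 = 0 by omega, hhead] at hlast
    exact hBnot (Or.inl (Option.some.inj hlast).symm)
  | some c =>
    rcases hl.1 0 x c hhead hc with h | h | h | h
    · have hnot := hG.not_reflTransGen_of_dir h
      have hZ : ∀ d, Relation.ReflTransGen (fun x y => dir x y ∨ und x y) c d →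
          d ∉ pa dir ({x} ∪ nbr und {x}) ∪ nbr und {x} := by
        rintro d hd (⟨-, w, rfl | ⟨-, y, rfl, hwy⟩, hdw⟩ | ⟨-, y, rfl, hdy⟩)
        · exact hnot (hd.tail (Or.inl hdw))
        · exact hnot ((hd.tail (Or.inl hdw)).tail (Or.inr hwy))
        · exact hnot (hd.tail (Or.inr hdy))
      obtain ⟨hlen, -⟩ := List.getElem?_eq_some_iff.1 hc
      rw [show l.length - 1 = (l.length - 2) + 1 by omega] at hlast
      have hcB := (hl.directed_of_dir hund hhead hc h hZ _ B hlast).2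
      have hBx : Relation.ReflTransGen und B x := by
        have : Std.Symm und := ⟨hund⟩
        exact Relation.ReflTransGen.stdSymm.symm _ _ hBco
      exact hnot (hcB.trans (Relation.ReflTransGen.mono (fun _ _ => Or.inr) _ _ hBx))
    · exact hblocked 0 c x (Or.inl rfl) hhead hc h
    · exact hundcase c hc h
    · exact hundcase c hc (hund _ _ h)
end

section
/- For every chain graph G over a finite vertex set V and every node A ∈ V, the separation A ⊥_G V ∖ ({A} ∪ de_G(A) ∪ pa_G(A)) | pa_G(A) holds. -/
/-- Truncating a chain at `b` and appending a successor `c` of `b` gives a chain. -/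
theorem chainRel_take_append {V : Type*} {R : V → V → Prop} {l : List V} {j : ℕ} {b c : V}
    (hb : l[j]? = some b) (hbc : R b c)
    (h : ∀ (i : ℕ) (x y : V), i < j → l[i]? = some x → l[i + 1]? = some y → R x y) :
    ChainRel R (l.take (j + 1) ++ [c]) := by
  intro i x y hx hy
  have hj : j < l.length := (List.getElem?_eq_some_iff.1 hb).1
  have hlen : (l.take (j + 1)).length = j + 1 := by simp; omega
  rcases lt_trichotomy i j with hi | rfl | hi
  · rw [List.getElem?_append_left (by omega), List.getElem?_take_of_lt (by omega)] at hx hy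
    exact h i x y hi hx hy
  · rw [List.getElem?_append_left (by omega), List.getElem?_take_of_lt (by omega)] at hx
    rw [List.getElem?_append_right (by omega)] at hy
    simp_all
  · rw [List.getElem?_eq_none (by simp; omega)] at hy
    simp at hy

/-- In a chain graph, no node reached from `A` by a descending route has an arrow to `A`. -/
theorem IsChainGraph.not_dir_of_descending {V : Type*} {dir und : V → V → Prop}
    (hG : IsChainGraph dir und) {l : List V} {j : ℕ} {A b : V}
    (hA : l.head? = some A) (hb : l[j]? = some b)
    (h : ∀ (i : ℕ) (x y : V), i < j → l[i]? = some x → l[i + 1]? = some y → dir x y ∨ und x y) :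
    ¬ dir b A := by
  intro hbA
  have hj : j < l.length := (List.getElem?_eq_some_iff.1 hb).1
  have hlen : (l.take (j + 1)).length = j + 1 := by simp; omega
  refine hG.2 (l.take (j + 1) ++ [A]) ⟨?_, ?_, chainRel_take_append hb (Or.inl hbA) h,
    j, b, A, ?_, ?_, hbA⟩
  · simp; omega
  · simp [List.head?_take, hA]
  · rw [List.getElem?_append_left (by omega), List.getElem?_take_of_lt (by omega), hb]
  · rw [List.getElem?_append_right (by omega), hlen]
    simp

/-- In a chain graph, a route from `A` that is open given the parents of `A`
is descending. -/
theorem ZOpen.chainRel_descending {V : Type*} {dir und : V → V → Prop}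
    (hG : IsChainGraph dir und) {l : List V} {A : V} (hA : l.head? = some A)
    (hl : ZOpen dir und (pa dir {A}) l) :
    ChainRel (fun a b => dir a b ∨ und a b) l := by
  obtain ⟨hroute, hmid, -, hlast⟩ := hl
  obtain ⟨hsymm, hirrefl, -, hasymm, hexcl⟩ := hG.1
  intro j
  induction j using Nat.strong_induction_on with
  | _ j ih =>
  intro b c hb hc
  rcases hroute j b c hb hc with h | hcb | h | h
  · exact Or.inl h
  · exfalso
    cases j with
    | zero =>
      obtain rfl : A = b := by rw [List.head?_eq_getElem?, hb] at hA; simpa using hA.symm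
      have hpa : c ∈ pa dir {A} := ⟨hirrefl c A hcb, A, rfl, hcb⟩
      cases hd : l[0 + 2]? with
      | none =>
        refine hlast c ?_ hpa
        have h₁ := (List.getElem?_eq_some_iff.1 hc).1
        have h₂ := List.getElem?_eq_none_iff.1 hd
        rw [List.getLast?_eq_getElem?, ← hc]
        congr 1
        omega
      | some d =>
        rcases (hmid 0 A c d hb hc hd).2 hpa with h | h | h
        · exact hasymm c A hcb h.1
        · exact hasymm c A hcb h.1
        · exact (hexcl c A hcb).2 h.1
    | succ i =>
      have hi : i < l.length := by
        have := (List.getElem?_eq_some_iff.1 hb).1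
        omega
      have ha : l[i]? = some l[i] := List.getElem?_eq_getElem hi
      have hpa : b ∈ pa dir {A} := by
        refine (hmid i _ b c ha hb hc).1 ?_
        rcases ih i (Nat.lt_succ_self i) _ b ha hb with h | h
        · exact Or.inl ⟨h, hcb⟩
        · exact Or.inr (Or.inr ⟨h, hcb⟩)
      obtain ⟨-, w, rfl, hbw⟩ := hpa
      exact hG.not_dir_of_descending hA hb (fun k x y hk => ih k hk x y) hbw
  · exact Or.inr h
  · exact Or.inr (hsymm _ _ h)

theorem stmt_4 {V : Type} [Fintype V] (dir und : V → V → Prop)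
    (hG : IsChainGraph dir und) (A : V) :
    Separ dir und {A} (Set.univ \ ({A} ∪ de dir und {A} ∪ pa dir {A})) (pa dir {A}) := by
  rintro ⟨l, x, y, rfl, ⟨-, hy⟩, hhead, hlast, hopen⟩
  refine hy (Or.inl ?_)
  by_cases hyx : y ∈ ({x} : Set V)
  · exact Or.inl hyx
  · exact Or.inr ⟨hyx, x, rfl, l, hhead, hlast, hopen.chainRel_descending hG hhead⟩
end

section
/- Let G be a chain graph over a finite vertex set V and let A, B be distinct nonadjacent nodes with B ∈ co_G(A). Then A ⊥_G B | pa_G({A} ∪ ne_G(A)) ∪ ne_G(A). -/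
theorem chainRel_of_isChain {V : Type*} {R : V → V → Prop} {l : List V} (h : l.IsChain R) :
    ChainRel R l := by
  intro i a b ha hb
  obtain ⟨_, rfl⟩ := List.getElem?_eq_some_iff.1 ha
  obtain ⟨hi, rfl⟩ := List.getElem?_eq_some_iff.1 hb
  exact List.isChain_iff_getElem.1 h i hi

/-- In a chain graph, no directed edge `b → a` closes a descending route from `a` to `b`. -/
theorem IsChainGraph.not_dir_of_reflTransGen {V : Type*} {dir und : V → V → Prop}
    (hG : IsChainGraph dir und) {a b : V}
    (hab : Relation.ReflTransGen (fun x y => dir x y ∨ und x y) a b) : ¬ dir b a := by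
  intro hba
  obtain ⟨l, hl, hlast⟩ := List.exists_isChain_cons_of_relationReflTransGen hab
  refine hG.2 (b :: a :: l) ⟨by simp, ?_, chainRel_of_isChain ?_, 0, b, a, rfl, rfl, hba⟩
  · rw [List.getLast?_cons_cons, List.getLast?_eq_some_getLast (List.cons_ne_nil a l), hlast]
    rfl
  · exact List.isChain_cons_cons.2 ⟨Or.inl hba, hl⟩

/-- A strict descendant of `A` is neither a neighbor of `A` nor a parent of `A` or of a
neighbor of `A`. -/
theorem IsChainGraph.notMem_of_reflTransGen_of_dir {V : Type*} {dir und : V → V → Prop}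
    (hG : IsChainGraph dir und) {A x y : V}
    (hx : Relation.ReflTransGen (fun x y => dir x y ∨ und x y) A x) (hxy : dir x y) :
    y ∉ pa dir ({A} ∪ nbr und {A}) ∪ nbr und {A} := by
  rintro (⟨-, w, rfl | ⟨-, _, rfl, hw⟩, hyw⟩ | ⟨-, _, rfl, hy⟩)
  · exact hG.not_dir_of_reflTransGen (.head (.inl hyw) hx) hxy
  · exact hG.not_dir_of_reflTransGen (.head (.inl hyw) (.head (.inr hw) hx)) hxy
  · exact hG.not_dir_of_reflTransGen (.head (.inr hy) hx) hxy

/-- An open route that leaves `A` by a directed edge out of `A` consists of directed edges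
pointing away from `A`. -/
theorem ZOpen.dir_of_dir {V : Type*} {dir und : V → V → Prop} (hG : IsChainGraph dir und)
    {A : V} {l : List V}
    (hl : ZOpen dir und (pa dir ({A} ∪ nbr und {A}) ∪ nbr und {A}) l)
    (h0 : l[0]? = some A) (h1 : ∀ v, l[1]? = some v → dir A v) (i : ℕ) {x y : V}
    (hx : l[i]? = some x) (hy : l[i + 1]? = some y) :
    Relation.ReflTransGen (fun x y => dir x y ∨ und x y) A x ∧ dir x y := by
  induction i generalizing x y with
  | zero =>
    obtain rfl : A = x := Option.some.inj (h0.symm.trans hx)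
    exact ⟨.refl, h1 y hy⟩
  | succ i ih =>
    obtain ⟨hi, -⟩ := List.getElem?_eq_some_iff.1 hx
    have hw : l[i]? = some l[i] := List.getElem?_eq_getElem (by omega)
    obtain ⟨hAw, hwx⟩ := ih hw hx
    have hnt := mt (hl.2.1 i _ x y hw hx hy).1 (hG.notMem_of_reflTransGen_of_dir hAw hwx)
    refine ⟨hAw.tail (.inl hwx), ?_⟩
    rcases hl.1 (i + 1) x y hx hy with h | h | h | h
    · exact h
    · exact absurd (.inl ⟨hwx, h⟩) hnt
    · exact absurd (.inr (.inl ⟨hwx, h⟩)) hnt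
    · exact absurd (.inr (.inl ⟨hwx, hG.1.1 _ _ h⟩)) hnt

/-- On an open route, a node with an outgoing edge to its predecessor is outside the
separating set. -/
theorem ZOpen.notMem_of_dir {V : Type*} {dir und : V → V → Prop} (hG : IsHybrid dir und)
    {Z : Set V} {l : List V} (hl : ZOpen dir und Z l) {i : ℕ} {x y : V}
    (hx : l[i]? = some x) (hy : l[i + 1]? = some y) (hyx : dir y x) : y ∉ Z := by
  obtain ⟨hi, -⟩ := List.getElem?_eq_some_iff.1 hy
  cases hz : l[i + 2]? with
  | none =>
    refine hl.2.2.2 y ?_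
    rw [List.getLast?_eq_getElem?, ← hy]
    congr 1
    have := List.getElem?_eq_none_iff.1 hz
    omega
  | some z =>
    rw [← hl.2.1 i x y z hx hy hz]
    rintro (⟨h, -⟩ | ⟨h, -⟩ | ⟨h, -⟩)
    · exact hG.2.2.2.1 _ _ h hyx
    · exact hG.2.2.2.1 _ _ h hyx
    · exact (hG.2.2.2.2 _ _ hyx).2 h

/-- The first edge of an open route starting at `A` is directed out of `A`. -/
theorem ZOpen.dir_of_head {V : Type*} {dir und : V → V → Prop} (hG : IsChainGraph dir und)
    {A v : V} {l : List V}
    (hl : ZOpen dir und (pa dir ({A} ∪ nbr und {A}) ∪ nbr und {A}) l)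
    (h0 : l[0]? = some A) (h1 : l[1]? = some v) : dir A v := by
  have hsymm := hG.1.1
  have hnd {x y : V} (hxy : Relation.ReflTransGen und x y) : ¬ dir y x :=
    hG.not_dir_of_reflTransGen (Relation.ReflTransGen.mono (fun _ _ => .inr) _ _ hxy)
  have hund (h : und A v) : False := by
    have hv : v ∈ nbr und {A} := ⟨(hG.1.2.2.1 _ _ h).symm, A, rfl, hsymm _ _ h⟩
    cases h2 : l[2]? with
    | none =>
      refine hl.2.2.2 v ?_ (.inr hv)
      rw [List.getLast?_eq_getElem?, ← h1]
      congr 1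
      have := List.getElem?_eq_none_iff.1 h2
      obtain ⟨hi, -⟩ := List.getElem?_eq_some_iff.1 h1
      omega
    | some w =>
      have hwv : dir w v := by
        rcases (hl.2.1 0 A v w h0 h1 h2).2 (.inr hv) with ⟨-, h'⟩ | ⟨h', -⟩ | ⟨-, h'⟩
        · exact h'
        · exact absurd h (hG.1.2.2.2.2 _ _ h').1
        · exact h'
      refine hl.notMem_of_dir hG.1 h1 h2 hwv (.inl ⟨?_, v, .inr hv, hwv⟩)
      rintro (rfl | ⟨-, _, rfl, hw⟩)
      · exact hnd (.single (hsymm _ _ h)) hwv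
      · exact hnd (.tail (.single (hsymm _ _ h)) (hsymm _ _ hw)) hwv
  rcases hl.1 0 A v h0 h1 with h | h | h | h
  · exact h
  · refine absurd (.inl ⟨?_, A, .inl rfl, h⟩) (hl.notMem_of_dir hG.1 h0 h1 h)
    rintro (rfl | ⟨-, _, rfl, hv⟩)
    · exact hnd .refl h
    · exact hnd (.single (hsymm _ _ hv)) h
  · exact (hund h).elim
  · exact (hund (hsymm _ _ h)).elim

theorem stmt_5 {V : Type} [Fintype V] (dir und : V → V → Prop)
    (hG : IsChainGraph dir und) (A B : V) (hAB : A ≠ B)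
    (hnadj : ¬ Adj dir und A B) (hco : B ∈ co und A) :
    Separ dir und {A} {B} (pa dir ({A} ∪ nbr und {A}) ∪ nbr und {A}) := by
  rintro ⟨l, _, _, rfl, rfl, hA, hB, hl⟩
  rename_i A B
  rw [List.head?_eq_getElem?] at hA
  rw [List.getLast?_eq_getElem?] at hB
  obtain ⟨hlen, -⟩ := List.getElem?_eq_some_iff.1 hA
  rcases hn : l.length with _ | _ | n
  · omega
  · simp only [hn] at hB
    exact hAB (Option.some.inj (hA.symm.trans hB))
  · have hn' : l.length - 1 = n + 1 := by omega
    rw [hn'] at hB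
    have hx : l[n]? = some l[n] := List.getElem?_eq_getElem (by omega)
    obtain ⟨hAx, hxB⟩ := hl.dir_of_dir hG hA (fun v hv => hl.dir_of_head hG hA hv) n hx hB
    have hBA : Relation.ReflTransGen und B A :=
      have : Std.Symm und := ⟨hG.1.1⟩
      Relation.ReflTransGen.stdSymm.symm _ _ hco
    exact hG.not_dir_of_reflTransGen
      ((Relation.ReflTransGen.mono (fun _ _ => .inr) _ _ hBA).trans hAx) hxB
end

section
/- Let G be a chain graph over a finite vertex set V and let A, B be distinct nonadjacent nodes with B ∉ de_G(A). Then A ⊥_G B | pa_G(A). -/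
/-- A descending initial segment of a list, from `x` to `a`, is closed up to a semidirected cycle
by a directed edge `a → x`. -/
theorem semidirectedCycle_cons_take {V : Type*} {dir und : V → V → Prop} {l : List V} {x a : V}
    {n : ℕ} (hx : l[0]? = some x) (ha : l[n]? = some a)
    (hl : ∀ i < n, ∀ c d, l[i]? = some c → l[i + 1]? = some d → dir c d ∨ und c d)
    (hax : dir a x) : SemidirectedCycle dir und (a :: l.take (n + 1)) := by
  have hn : n < l.length := (List.getElem?_eq_some_iff.1 ha).1
  have hlen : (l.take (n + 1)).length = n + 1 := by
    rw [List.length_take]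
    omega
  refine ⟨by simp only [List.length_cons, hlen]; omega, ?_, ?_, 0, a, x, rfl, ?_, hax⟩
  · rw [List.getLast?_eq_getElem?, List.length_cons, hlen]
    simp [ha]
  · intro i c d hc hd
    rw [List.getElem?_cons_succ, List.getElem?_take] at hd
    split_ifs at hd with hi
    cases i with
    | zero =>
      obtain rfl : a = c := by simpa using hc
      obtain rfl : x = d := by simpa [hx] using hd
      exact Or.inl hax
    | succ i =>
      rw [List.getElem?_cons_succ, List.getElem?_take, if_pos (by omega)] at hc
      exact hl i (by omega) c d hc hd
  · simp [hx]

theorem stmt_6 {V : Type} [Fintype V] (dir und : V → V → Prop)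
    (hG : IsChainGraph dir und) (A B : V) (hAB : A ≠ B)
    (hnadj : ¬ Adj dir und A B) (hde : B ∉ de dir und {A}) :
    Separ dir und {A} {B} (pa dir {A}) := by
  rintro ⟨l, x, y, rfl, rfl, hx, hy, hadj, hopen, -, -⟩
  obtain ⟨⟨hsymm, -, -, hasymm, hexcl⟩, hcyc⟩ := hG
  have hx0 : l[0]? = some x := by rw [← List.head?_eq_getElem?, hx]
  have hdesc : ChainRel (fun a b => dir a b ∨ und a b) l := by
    intro i
    induction i using Nat.strong_induction_on with
    | _ i ih =>
      intro a b ha hb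
      have hab := hadj i a b ha hb
      by_contra hnd
      have hba : dir b a := by
        rcases hab with h | h | h | h
        · exact absurd (Or.inl h) hnd
        · exact h
        · exact absurd (Or.inr h) hnd
        · exact absurd (Or.inr (hsymm _ _ h)) hnd
      cases i with
      | zero =>
        obtain rfl : x = a := by simpa [hx0] using ha
        cases hc : l[2]? with
        | none =>
          have hlen : l.length = 2 := by
            have h1 := List.getElem?_eq_none_iff.1 hc
            have h2 := (List.getElem?_eq_some_iff.1 hb).1
            omega
          rw [List.getLast?_eq_getElem?, hlen] at hy
          obtain rfl : b = y := by simpa [hb] using hy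
          exact hnadj hab
        | some c =>
          have hbx : b ∈ pa dir {x} := by
            refine ⟨?_, x, rfl, hba⟩
            rintro rfl
            exact hasymm _ _ hba hba
          rcases (hopen 0 x b c ha hb hc).2 hbx with h | h | h
          · exact hnd (Or.inl h.1)
          · exact hnd (Or.inl h.1)
          · exact hnd (Or.inr h.1)
      | succ k =>
        have hk : k + 1 < l.length := (List.getElem?_eq_some_iff.1 ha).1
        have hp : l[k]? = some l[k] := List.getElem?_eq_getElem (by omega)
        have hhead : HeadNoTail dir und l[k] a b := by
          rcases ih k (by omega) _ _ hp ha with h | h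
          · exact Or.inl ⟨h, hba⟩
          · exact Or.inr (Or.inr ⟨h, hba⟩)
        obtain ⟨-, w, hw, haw⟩ := (hopen k _ a b hp ha hb).1 hhead
        obtain rfl : w = x := hw
        exact hcyc _ (semidirectedCycle_cons_take hx0 ha
          (fun i hi c d hc hd => ih i hi c d hc hd) haw)
  exact hde ⟨fun h => hAB h.symm, x, rfl, l, hx, hy, hdesc⟩
end

section
/- Let G be a chain graph over a finite vertex set V, let A and C be distinct nodes, let S ⊆ V ∖ {A, C} satisfy A ⊥_G C | S, and let B be a node adjacent to both A and C with B ∉ S. Then G has a triplex ({A,C},B). -/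
/-- An edge between two nodes outside `Z` is a `Z`-open route. -/
theorem zOpen_pair {V : Type} {dir und : V → V → Prop} {Z : Set V} {a b : V}
    (hab : Adj dir und a b) (ha : a ∉ Z) (hb : b ∉ Z) : ZOpen dir und Z [a, b] := by
  refine ⟨?_, ?_, by simpa using ha, by simpa using hb⟩
  · rintro (_ | i) x y hx hy <;> simp_all
  · rintro i x y z - - hz
    simp at hz

/-- A route through one intermediate node, all of whose nodes are outside `Z`, is `Z`-open
if the intermediate node is not a head-no-tail node. -/
theorem zOpen_triple {V : Type} {dir und : V → V → Prop} {Z : Set V} {a b c : V}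
    (hab : Adj dir und a b) (hbc : Adj dir und b c) (ha : a ∉ Z) (hb : b ∉ Z) (hc : c ∉ Z)
    (h : ¬ HeadNoTail dir und a b c) : ZOpen dir und Z [a, b, c] := by
  refine ⟨?_, ?_, by simpa using ha, by simpa using hc⟩
  · rintro (_ | _ | i) x y hx hy <;> simp_all
  · rintro (_ | i) x y z hx hy hz <;> simp_all

theorem stmt_8 {V : Type} [Fintype V] (dir und : V → V → Prop)
    (hG : IsChainGraph dir und) (A B C : V) (hAC : A ≠ C) (S : Set V)
    (hSsub : S ⊆ ({A, C} : Set V)ᶜ) (hsep : Separ dir und {A} {C} S)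
    (hBA : Adj dir und B A) (hBC : Adj dir und B C) (hBS : B ∉ S) :
    Triplex dir und A B C := by
  have hA : A ∉ S := fun h => hSsub h (by simp)
  have hC : C ∉ S := fun h => hSsub h (by simp)
  have hAB : Adj dir und A B := by unfold Adj at hBA ⊢; tauto
  refine ⟨hAC, fun h => hsep ⟨[A, C], A, C, rfl, rfl, rfl, rfl, zOpen_pair h hA hC⟩, ?_⟩
  by_contra h
  exact hsep ⟨[A, B, C], A, C, rfl, rfl, rfl, rfl, zOpen_triple hAB hBC hA hBS hC h⟩
end

section
/- Let G be a chain graph over a finite vertex set V in which A → B or A − B is in G, B is adjacent to C, A and C are nonadjacent, and there is S ⊆ V ∖ {A, C} with A ⊥_G C | S and B ∈ S. Then B → C or B − C is in G (equivalently, C → B is not in G). -/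
/-- A head-no-tail node in the conditioning set opens the three-node route through it. -/
theorem zOpen_of_headNoTail {V : Type*} {dir und : V → V → Prop} {S : Set V} {a b c : V}
    (hab : Adj dir und a b) (hbc : Adj dir und b c) (h : HeadNoTail dir und a b c)
    (ha : a ∉ S) (hb : b ∈ S) (hc : c ∉ S) : ZOpen dir und S [a, b, c] := by
  refine ⟨?_, ?_, by simpa using ha, by simpa using hc⟩
  · rintro (_ | _ | i) x y hx hy
    · simp at hx hy
      rwa [← hx, ← hy]
    · simp at hx hy
      rwa [← hx, ← hy]
    · simp at hy
  · rintro (_ | i) x y z hx hy hz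
    · simp at hx hy hz
      subst hx hy hz
      exact iff_of_true h hb
    · simp at hz

theorem stmt_10 {V : Type} [Fintype V] (dir und : V → V → Prop)
    (hG : IsChainGraph dir und) (A B C : V)
    (hAB : dir A B ∨ und A B) (hBC : Adj dir und B C)
    (hAC : A ≠ C) (hnadj : ¬ Adj dir und A C)
    (S : Set V) (hSsub : S ⊆ ({A, C} : Set V)ᶜ)
    (hsep : Separ dir und {A} {C} S) (hBS : B ∈ S) :
    dir B C ∨ und B C := by
  rcases id hBC with h | h | h | h
  · exact Or.inl h
  · refine absurd ⟨[A, B, C], A, C, rfl, rfl, rfl, rfl, ?_⟩ hsep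
    have hA : A ∉ S := fun hA => hSsub hA (by simp)
    have hC : C ∉ S := fun hC => hSsub hC (by simp)
    refine zOpen_of_headNoTail ?_ hBC ?_ hA hBS hC
    · rcases hAB with hd | hu
      · exact Or.inl hd
      · exact Or.inr (Or.inr (Or.inl hu))
    · rcases hAB with hd | hu
      · exact Or.inl ⟨hd, h⟩
      · exact Or.inr (Or.inr ⟨hu, h⟩)
  · exact Or.inr h
  · exact Or.inr (hG.1.1 _ _ h)
end

section
/- Let G be a chain graph over a finite vertex set V in which: A is adjacent to each of B, C and D; B is adjacent to C and to D, and neither B → C nor B → D is in G; C and D are nonadjacent; and there is S ⊆ V ∖ {C, D} with C ⊥_G D | S, A ∈ S and B ∉ S. Then A → B or A − B is in G (equivalently, B → A is not in G). -/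
/-- In a chain graph, if `X → B` or `X − B`, `B → A`, and `A` and `X` are adjacent, then
`X → A`. -/
theorem IsChainGraph.dir_of_desc_of_dir {V : Type*} {dir und : V → V → Prop}
    (hG : IsChainGraph dir und) {A B X : V} (hAX : Adj dir und A X)
    (hXB : dir X B ∨ und X B) (hBA : dir B A) : dir X A := by
  by_contra hXA
  have hd : dir A X ∨ und A X := by
    rcases hAX with h | h | h | h
    · exact Or.inl h
    · exact absurd h hXA
    · exact Or.inr h
    · exact Or.inr (hG.1.1 _ _ h)
  refine hG.2 [X, B, A, X] ⟨by simp, by simp, ?_, 1, B, A, by simp, by simp, hBA⟩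
  rintro (_ | _ | _ | i) a b ha hb <;> simp at ha hb
  · subst ha hb; exact hXB
  · subst ha hb; exact Or.inl hBA
  · subst ha hb; exact hd

/-- A collider in the conditioning set makes the route through it open. -/
theorem not_separ_of_dir_of_dir {V : Type*} {dir und : V → V → Prop} {A C D : V} {S : Set V}
    (hCA : dir C A) (hDA : dir D A) (hA : A ∈ S) (hC : C ∉ S) (hD : D ∉ S) :
    ¬ Separ dir und {C} {D} S := by
  refine not_not_intro ⟨[C, A, D], C, D, rfl, rfl, rfl, rfl, ?_, ?_, ?_, ?_⟩
  · rintro (_ | _ | i) a b ha hb <;> simp at ha hb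
    · subst ha hb; exact Or.inl hCA
    · subst ha hb; exact Or.inr (Or.inl hDA)
  · rintro (_ | i) a b c ha hb hc <;> simp at ha hb hc
    subst ha hb hc
    exact iff_of_true (Or.inl ⟨hCA, hDA⟩) hA
  · simpa using hC
  · simpa using hD

theorem stmt_12 {V : Type} [Fintype V] (dir und : V → V → Prop)
    (hG : IsChainGraph dir und) (A B C D : V)
    (hAB : Adj dir und A B) (hAC : Adj dir und A C) (hAD : Adj dir und A D)
    (hBC : Adj dir und B C) (hBD : Adj dir und B D)
    (hnBC : ¬ dir B C) (hnBD : ¬ dir B D)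
    (hCD : C ≠ D) (hnadjCD : ¬ Adj dir und C D)
    (S : Set V) (hSsub : S ⊆ ({C, D} : Set V)ᶜ)
    (hsep : Separ dir und {C} {D} S) (hA : A ∈ S) (hB : B ∉ S) :
    dir A B ∨ und A B := by
  by_contra h
  have hBA : dir B A := by
    rcases hAB with h' | h' | h' | h'
    · exact absurd (Or.inl h') h
    · exact h'
    · exact absurd (Or.inr h') h
    · exact absurd (Or.inr (hG.1.1 _ _ h')) h
  have toB : ∀ X, Adj dir und B X → ¬ dir B X → dir X B ∨ und X B := by
    rintro X (h' | h' | h' | h') hn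
    · exact absurd h' hn
    · exact Or.inl h'
    · exact Or.inr (hG.1.1 _ _ h')
    · exact Or.inr h'
  exact not_separ_of_dir_of_dir
    (hG.dir_of_desc_of_dir hAC (toB C hBC hnBC) hBA)
    (hG.dir_of_desc_of_dir hAD (toB D hBD hnBD) hBA) hA
    (fun hC => hSsub hC (by simp)) (fun hD => hSsub hD (by simp)) hsep
end

section
/- In the blocked graph H (the least set of blocks over the skeleton of G closed under the rules R1–R4), there are no three pairwise adjacent nodes A, B, C such that the A-end of the edge A–B is blocked while both ends of the edge B–C and both ends of the edge A–C are unblocked. -/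
/-- The least set of blocks over the skeleton of the graph closed under the rules
R1-R4. `Blocked dir und S a b` means that the `a`-end of the edge `a - b` is blocked.
`S A B` is the fixed separator found for the nonadjacent pair `{A, B}`. -/
inductive Blocked (dir und : V → V → Prop) (S : V → V → Set V) : V → V → Prop where
  /-- R1 blocks the `A`-end of the edge `A - B`. -/
  | R1a (A B C : V) : Adj dir und A B → Adj dir und B C → A ≠ C → ¬ Adj dir und A C →
      B ∉ S A C → Blocked dir und S A B
  /-- R1 blocks the `C`-end of the edge `B - C`. -/
  | R1b (A B C : V) : Adj dir und A B → Adj dir und B C → A ≠ C → ¬ Adj dir und A C →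
      B ∉ S A C → Blocked dir und S C B
  | R2 (A B C : V) : Blocked dir und S A B → Adj dir und B C → A ≠ C → ¬ Adj dir und A C →
      B ∈ S A C → Blocked dir und S B C
  | R3 (A B : V) (l : List V) : l.head? = some A → l.getLast? = some B → 2 ≤ l.length →
      (∀ (i : ℕ) (a b : V), l[i]? = some a → l[i + 1]? = some b → Adj dir und a b) →
      (∀ (i : ℕ) (a b : V), l[i]? = some a → l[i + 1]? = some b → Blocked dir und S a b) →
      Adj dir und A B → Blocked dir und S A B
  | R4 (A B C D : V) : Adj dir und A B → Adj dir und A C → Adj dir und A D →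
      Adj dir und C B → Adj dir und D B → Blocked dir und S C B → Blocked dir und S D B →
      C ≠ D → ¬ Adj dir und C D → A ∈ S C D → B ∉ S C D → Blocked dir und S A B

/-- The directed edges of the hybrid graph `H'` obtained from the closed blocked graph:
an edge whose `a`-end is blocked and whose `b`-end is unblocked is directed as `a → b`. -/
def blkDir (dir und : V → V → Prop) (S : V → V → Set V) (a b : V) : Prop :=
  Adj dir und a b ∧ Blocked dir und S a b ∧ ¬ Blocked dir und S b a

/-- The undirected edges of the hybrid graph `H'` obtained from the closed blocked graph:
an edge with both ends blocked or both ends unblocked is undirected. -/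
def blkUnd (dir und : V → V → Prop) (S : V → V → Set V) (a b : V) : Prop :=
  Adj dir und a b ∧ (Blocked dir und S a b ↔ Blocked dir und S b a)

section

variable {V : Type} {dir und : V → V → Prop} {S : V → V → Set V}

theorem Adj.symm {a b : V} (h : Adj dir und a b) : Adj dir und b a := by
  unfold Adj at *
  tauto

theorem Blocked.adj {a b : V} (h : Blocked dir und S a b) : Adj dir und a b := by
  cases h with
  | R1a _ _ _ h _ _ _ _ => exact h
  | R1b _ _ _ _ h _ _ _ => exact h.symm
  | R2 _ _ _ _ h _ _ _ => exact h
  | R3 _ _ _ _ _ _ _ _ h => exact h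
  | R4 _ _ _ _ h _ _ _ _ _ _ _ _ _ _ => exact h

/-- R3 applied to a route of blocked edges prolonged by one blocked edge. -/
theorem Blocked.of_route_concat {a b c : V} {l : List V} (ha : l.head? = some a)
    (hb : l.getLast? = some b)
    (hl : ∀ (i : ℕ) (x y : V), l[i]? = some x → l[i + 1]? = some y → Blocked dir und S x y)
    (hbc : Blocked dir und S b c) (hac : Adj dir und a c) : Blocked dir und S a c := by
  have hne : l ≠ [] := by rintro rfl; simp at ha
  have hpos : 0 < l.length := List.length_pos_iff.2 hne
  have key : ∀ (i : ℕ) (x y : V), (l ++ [c])[i]? = some x → (l ++ [c])[i + 1]? = some y →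
      Blocked dir und S x y := by
    intro i x y hx hy
    rcases lt_trichotomy (i + 1) l.length with h | h | h
    · rw [List.getElem?_append_left (by omega)] at hx hy
      exact hl i x y hx hy
    · rw [List.getElem?_append_left (by omega)] at hx
      rw [List.getLast?_eq_getElem?, ← h, Nat.add_sub_cancel, hx] at hb
      rw [h, List.getElem?_concat_length] at hy
      cases hb
      cases hy
      exact hbc
    · rw [List.getElem?_eq_none (by simp; omega)] at hy
      cases hy
  refine Blocked.R3 a c (l ++ [c]) ?_ (by simp) (by simp; omega)
    (fun i x y hx hy => (key i x y hx hy).adj) key hac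
  rw [List.head?_append, ha, Option.some_or]

theorem Blocked.trans_of_adj {a b c : V} (hab : Blocked dir und S a b)
    (hbc : Blocked dir und S b c) (hac : Adj dir und a c) : Blocked dir und S a c := by
  refine Blocked.of_route_concat (l := [a, b]) rfl rfl ?_ hbc hac
  rintro (_ | _ | i) x y hx hy <;> simp_all

/-- A blocked edge into a fully unblocked edge can only occur inside a triangle. -/
theorem Blocked.adj_of_unblocked {a b c : V} (hab : Blocked dir und S a b)
    (hbc : Adj dir und b c) (h₁ : ¬ Blocked dir und S b c) (h₂ : ¬ Blocked dir und S c b) :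
    Adj dir und a c := by
  by_contra hac
  have hne : a ≠ c := by rintro rfl; exact h₂ hab
  by_cases hb : b ∈ S a c
  · exact h₁ (.R2 a b c hab hbc hne hac hb)
  · exact h₂ (.R1b a b c hab.adj hbc hne hac hb)

theorem Blocked.false_of_unshielded {a b c d : V} (hab : Blocked dir und S a b)
    (hdb : Blocked dir und S d b) (hne : a ≠ d) (had : ¬ Adj dir und a d) (hb : b ∉ S a d)
    (hc : c ∈ S a d) (hca : Adj dir und c a) (hcd : Adj dir und c d) (hcb : Adj dir und c b)
    (h : ¬ Blocked dir und S c b) : False :=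
  h (.R4 c b a d hcb hca hcd hab.adj hdb.adj hab hdb hne had hc hb)

theorem Blocked.false_of_collider {a b c d : V} (hab : Blocked dir und S a b)
    (hdb : Blocked dir und S d b) (hne : a ≠ d) (had : ¬ Adj dir und a d) (hb : b ∉ S a d)
    (hbc : Adj dir und b c) (hac : Adj dir und a c)
    (h₁ : ¬ Blocked dir und S b c) (h₂ : ¬ Blocked dir und S c b)
    (h₃ : ¬ Blocked dir und S a c) : False := by
  have hdc := hdb.adj_of_unblocked hbc h₁ h₂
  by_cases hc : c ∈ S a d
  · exact hab.false_of_unshielded hdb hne had hb hc hac.symm hdc.symm hbc.symm h₂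
  · exact h₃ (.R1a a c d hac hdc.symm hne had hc)

theorem Blocked.not_unblocked_triangle (hS : ∀ a b, S a b = S b a) {a b : V} (h : Blocked dir und S a b) :
    ∀ c, Adj dir und b c → Adj dir und a c → ¬ Blocked dir und S b c →
      ¬ Blocked dir und S c b → ¬ Blocked dir und S a c → ¬ Blocked dir und S c a → False := by
  induction h with
  | R1a a b d hab hbd hne had hb =>
    intro c hbc hac h₁ h₂ h₃ _
    exact (Blocked.R1a a b d hab hbd hne had hb).false_of_collider
      (.R1b a b d hab hbd hne had hb) hne had hb hbc hac h₁ h₂ h₃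
  | R1b d b a hdb hba hne hda hb =>
    intro c hbc hac h₁ h₂ h₃ _
    exact (Blocked.R1b d b a hdb hba hne hda hb).false_of_collider
      (.R1a d b a hdb hba hne hda hb) hne.symm (fun h => hda h.symm) (hS d a ▸ hb)
      hbc hac h₁ h₂ h₃
  | R2 d a b hda hab hne hdb ha ih =>
    intro c hbc hac h₁ h₂ h₃ h₄
    have hdc := hda.adj_of_unblocked hac h₃ h₄
    have hc : c ∈ S d b := by
      by_contra hc
      exact h₁ (.R1b d c b hdc hbc.symm hne hdb hc)
    refine ih c hac hdc h₃ h₄ (fun h => h₂ (.R2 d c b h hbc.symm hne hdb hc)) ?_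
    exact fun h => h₄ (h.trans_of_adj hda hac.symm)
  | R3 a b l ha hb hlen _ hl hab ih =>
    intro c hbc hac h₁ h₂ h₃ h₄
    have hlt : l.length - 2 < l.length := by omega
    obtain ⟨v, hv⟩ : ∃ v, l[l.length - 2]? = some v := ⟨_, List.getElem?_eq_getElem hlt⟩
    have hb' : l[l.length - 2 + 1]? = some b := by
      rw [← hb, List.getLast?_eq_getElem?]
      congr 1
      omega
    have hvb := hl _ _ _ hv hb'
    have hvc := hvb.adj_of_unblocked hbc h₁ h₂
    refine ih _ _ _ hv hb' c hbc hvc h₁ h₂ (fun h => h₃ ?_)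
      fun h => h₂ (h.trans_of_adj hvb hbc.symm)
    refine Blocked.of_route_concat (l := l.take (l.length - 1)) ?_ ?_ ?_ h hac
    · rw [List.head?_take, if_neg (by omega), ha]
    · rw [List.getLast?_take, if_neg (by omega), show l.length - 1 - 1 = l.length - 2 by omega, hv,
        Option.some_or]
    · intro i x y hx hy
      simp only [List.getElem?_take] at hx hy
      split_ifs at hx hy
      exact hl i x y hx hy
  | R4 a b e f hab hae haf _ _ heb hfb hne hef ha hb _ _ =>
    intro c hbc hac h₁ h₂ h₃ _
    have hec := heb.adj_of_unblocked hbc h₁ h₂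
    have hfc := hfb.adj_of_unblocked hbc h₁ h₂
    by_cases hc : c ∈ S e f
    · exact heb.false_of_unshielded hfb hne hef hb hc hec.symm hfc.symm hbc.symm h₂
    · exact (Blocked.R1a e c f hec hfc.symm hne hef hc).false_of_unshielded
        (.R1b e c f hec hfc.symm hne hef hc) hne hef hc ha hae haf hac h₃

end

theorem stmt_13 {V : Type} [Fintype V] (dir und : V → V → Prop)
    (hG : IsChainGraph dir und) (S : V → V → Set V)
    (hSsymm : ∀ A B : V, S A B = S B A)
    (hSsep : ∀ A B : V, A ≠ B → ¬ Adj dir und A B →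
      S A B ⊆ ({A, B} : Set V)ᶜ ∧ Separ dir und {A} {B} (S A B)) :
    ¬ ∃ A B C : V, Adj dir und A B ∧ Adj dir und B C ∧ Adj dir und A C ∧
      Blocked dir und S A B ∧
      ¬ Blocked dir und S B C ∧ ¬ Blocked dir und S C B ∧
      ¬ Blocked dir und S A C ∧ ¬ Blocked dir und S C A := by
  rintro ⟨A, B, C, -, hBC, hAC, hAB, h₁, h₂, h₃, h₄⟩
  exact hAB.not_unblocked_triangle hSsymm C hBC hAC h₁ h₂ h₃ h₄
end
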